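/- arXiv:math/0701709 — 2 statements merged into one kernel-verified Lean document; each statement's English description precedes it below -/
import Mathlib

section
/- Let G be a finite abelian group containing an element g with g² ≠ 1. Let α = γ = ((x,y) ↦ xy), β ∈ {xy, x⁻¹y}, and δ ∈ {xy, x⁻¹y, xy⁻¹, x⁻¹y⁻¹}. Then the magma G(α,β,γ,δ) satisfies the left alternative law x*(x*y) = (x*x)*y for all x, y ∈ G ∪ Ḡ if and only if either (i) (β,δ) ∈ {(xy, xy), (xy, x⁻¹y), (x⁻¹y, x⁻¹y)}, or (ii) g⁴ = 1 for all g ∈ G and (β,δ) = (x⁻¹y, xy). -/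
/-- A binary operation on `G`. -/
abbrev Op (G : Type*) := G → G → G

variable {G : Type*}

/-- `(x,y) ↦ xy` -/
def oXY [Group G] : Op G := fun x y => x * y
/-- `(x,y) ↦ xy⁻¹` -/
def oXYi [Group G] : Op G := fun x y => x * y⁻¹
/-- `(x,y) ↦ x⁻¹y` -/
def oXiY [Group G] : Op G := fun x y => x⁻¹ * y
/-- `(x,y) ↦ x⁻¹y⁻¹` -/
def oXiYi [Group G] : Op G := fun x y => x⁻¹ * y⁻¹
/-- `(x,y) ↦ yx` -/
def oYX [Group G] : Op G := fun x y => y * x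
/-- `(x,y) ↦ yx⁻¹` -/
def oYXi [Group G] : Op G := fun x y => y * x⁻¹
/-- `(x,y) ↦ y⁻¹x` -/
def oYiX [Group G] : Op G := fun x y => y⁻¹ * x
/-- `(x,y) ↦ y⁻¹x⁻¹` -/
def oYiXi [Group G] : Op G := fun x y => y⁻¹ * x⁻¹

/-- The set `Θ` of eight multiplicative operations. -/
def Theta (G : Type*) [Group G] : Set (Op G) :=
  {oXY, oXYi, oXiY, oXiYi, oYX, oYXi, oYiX, oYiXi}

/-- The multiplication of the magma `G(α,β,γ,δ)` on `G ∪ Ḡ`, realized on `G × Bool`;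
`(g, false)` stands for `g ∈ G` and `(g, true)` stands for `ḡ ∈ Ḡ`. -/
def cmul (α β γ δ : Op G) : G × Bool → G × Bool → G × Bool
  | (g, false), (h, false) => (α g h, false)
  | (g, false), (h, true)  => (β g h, true)
  | (g, true),  (h, false) => (γ g h, true)
  | (g, true),  (h, true)  => (δ g h, false)

/-- The multiplication of the Chein loop `M(G,2) = G(xy, yx, xy⁻¹, y⁻¹x)`. -/
def chein [Group G] : G × Bool → G × Bool → G × Bool := cmul oXY oYX oXYi oYiX

/-- Isomorphism of magmas: a bijection respecting the two multiplications. -/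
def MagIso {A B : Type*} (m : A → A → A) (n : B → B → B) : Prop :=
  ∃ f : A ≃ B, ∀ a b, f (m a b) = n (f a) (f b)

/-- Left alternative law in the abelian case. -/
theorem statement4 [CommGroup G] [Finite G] (hg : ∃ g : G, g ^ 2 ≠ 1)
    (β δ : Op G) (hβ : β ∈ ({oXY, oXiY} : Set (Op G)))
    (hδ : δ ∈ ({oXY, oXiY, oXYi, oXiYi} : Set (Op G))) :
    (∀ x y : G × Bool,
        cmul oXY β oXY δ x (cmul oXY β oXY δ x y) =
          cmul oXY β oXY δ (cmul oXY β oXY δ x x) y) ↔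
      ((β, δ) ∈ ({(oXY, oXY), (oXY, oXiY), (oXiY, oXiY)} : Set (Op G × Op G)) ∨
        ((∀ g : G, g ^ 4 = 1) ∧ (β, δ) = ((oXiY : Op G), (oXY : Op G)))) := by
  obtain ⟨g, hg⟩ := hg
  constructor
  · intro H
    rcases hδ with rfl | rfl | rfl | rfl
    · rcases hβ with rfl | rfl
      · exact Or.inl (Or.inl rfl)
      · refine Or.inr ⟨fun a => ?_, rfl⟩
        have h : a * (a * 1) = (a * a)⁻¹ * 1 := congrArg Prod.fst (H (a, true) (1, true))
        rw [mul_one, mul_one, eq_inv_iff_mul_eq_one] at h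
        rw [← h, pow_succ, pow_succ, sq, ← mul_assoc]
    · rcases hβ with rfl | rfl
      · exact Or.inl (Or.inr (Or.inl rfl))
      · exact Or.inl (Or.inr (Or.inr rfl))
    · have h : 1 * (1 * g)⁻¹ = 1 * 1⁻¹ * g := congrArg Prod.fst (H (1, true) (g, false))
      refine absurd ?_ hg
      rw [sq, ← inv_eq_iff_mul_eq_one]
      simpa using h
    · have h : 1⁻¹ * (1 * g)⁻¹ = 1⁻¹ * 1⁻¹ * g := congrArg Prod.fst (H (1, true) (g, false))
      refine absurd ?_ hg
      rw [sq, ← inv_eq_iff_mul_eq_one]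
      simpa using h
  · rintro ((h | h | h) | ⟨h4, h⟩) <;> obtain ⟨rfl, rfl⟩ := Prod.mk.inj h <;>
      rintro ⟨x, _ | _⟩ ⟨y, _ | _⟩ <;> simp [cmul, oXY, oXiY, mul_assoc]
    rw [eq_inv_mul_iff_mul_eq, eq_inv_mul_iff_mul_eq]
    simpa [pow_succ, mul_assoc] using congrArg (· * y) (h4 x)
end

section
/- Let G be a finite nonabelian group. Let α = ((x,y) ↦ xy), β ∈ {xy, yx, yx⁻¹, x⁻¹y}, γ ∈ {xy, yx}, and δ ∈ Θ. Then G(α,β,γ,δ) satisfies the left alternative law x*(x*y) = (x*x)*y for all x, y ∈ G ∪ Ḡ if and only if one of the following holds: (i) (γ,δ) ∈ {(xy, x⁻¹y), (yx, yx⁻¹)}; (ii) (β,γ,δ) = (xy, xy, xy); (iii) g² is central in G for every g ∈ G, and (β,γ,δ) ∈ {(yx, xy, xy), (xy, yx, yx), (yx, yx, yx)}; (iv) g⁴ = 1 for all g ∈ G and (β,γ,δ) = (x⁻¹y, xy, xy); (v) g² is central in G and g⁴ = 1 for every g ∈ G, and (β,γ,δ) ∈ {(yx⁻¹, xy, xy),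 (yx⁻¹, yx, yx), (x⁻¹y, yx, yx)}. -/
variable {G : Type*}

/-- The left alternative law in `G(xy,β,γ,δ)`, split according to which of the two elements
are barred; the case of two unbarred elements always holds. -/
theorem cmul_leftAlternative_iff [Group G] (β γ δ : Op G) :
    (∀ x y : G × Bool,
        cmul oXY β γ δ x (cmul oXY β γ δ x y) =
          cmul oXY β γ δ (cmul oXY β γ δ x x) y) ↔
      (∀ g h, β g (β g h) = β (g * g) h) ∧
      (∀ g h, δ g (γ g h) = δ g g * h) ∧
      (∀ g h, γ g (δ g h) = β (δ g g) h) := by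
  constructor
  · intro H
    refine ⟨fun g h => ?_, fun g h => ?_, fun g h => ?_⟩
    · exact congrArg Prod.fst (H (g, false) (h, true))
    · exact congrArg Prod.fst (H (g, true) (h, false))
    · exact congrArg Prod.fst (H (g, true) (h, true))
  · rintro ⟨h₁, h₂, h₃⟩ ⟨g, _ | _⟩ ⟨h, _ | _⟩
    · exact Prod.ext (mul_assoc g g h).symm rfl
    · exact Prod.ext (h₁ g h) rfl
    · exact Prod.ext (h₂ g h) rfl
    · exact Prod.ext (h₃ g h) rfl

theorem beta_leftAlternative [Group G] {β : Op G}
    (hβ : β ∈ ({oXY, oYX, oYXi, oXiY} : Set (Op G))) (g h : G) :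
    β g (β g h) = β (g * g) h := by
  rcases hβ with rfl | rfl | rfl | rfl <;> simp [oXY, oYX, oYXi, oXiY, mul_assoc]

theorem beta_one_left [Group G] {β : Op G}
    (hβ : β ∈ ({oXY, oYX, oYXi, oXiY} : Set (Op G))) (h : G) : β 1 h = h := by
  rcases hβ with rfl | rfl | rfl | rfl <;> simp [oXY, oYX, oYXi, oXiY]

theorem exists_inv_ne_self [Group G] (hna : ∃ a b : G, a * b ≠ b * a) : ∃ h : G, h⁻¹ ≠ h := by
  by_contra! H
  obtain ⟨a, b, hab⟩ := hna
  exact hab (by rw [← H (a * b), mul_inv_rev, H, H])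

/-- The pairs `(γ, δ)` for which the left alternative law can hold with `x` barred, `y` unbarred. -/
theorem gamma_delta_of_leftAlternative [Group G] (hna : ∃ a b : G, a * b ≠ b * a)
    {γ δ : Op G} (hγ : γ ∈ ({oXY, oYX} : Set (Op G))) (hδ : δ ∈ Theta G)
    (H : ∀ g h, δ g (γ g h) = δ g g * h) :
    (γ, δ) ∈ ({(oXY, oXiY), (oYX, oYXi)} : Set (Op G × Op G)) ∨
      (γ = oXY ∧ δ = oXY) ∨
      (γ = oYX ∧ δ = oYX ∧ ∀ g x : G, g ^ 2 * x = x * g ^ 2) := by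
  obtain ⟨c, hc⟩ := exists_inv_ne_self hna
  obtain ⟨a, b, hab⟩ := hna
  have h₁ := H 1 c
  have h₂ := H a b
  rcases hγ with rfl | rfl
  · rcases hδ with rfl | rfl | rfl | rfl | rfl | rfl | rfl | rfl
    · exact .inr (.inl ⟨rfl, rfl⟩)
    · exact absurd (by simpa [oXY, oXYi] using h₁) hc
    · exact .inl (.inl rfl)
    · exact absurd (by simpa [oXY, oXiYi] using h₁) hc
    · exact absurd (by simpa [oXY, oYX, mul_assoc] using h₂.symm) hab
    · exact absurd (by simpa [oXY, oYXi, mul_inv_eq_iff_eq_mul] using h₂) hab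
    · exact absurd (by simpa [oXY, oYiX] using h₁) hc
    · exact absurd (by simpa [oXY, oYiXi] using h₁) hc
  · rcases hδ with rfl | rfl | rfl | rfl | rfl | rfl | rfl | rfl
    · exact absurd (by simpa [oXY, oYX, mul_assoc] using h₂.symm) hab
    · exact absurd (by simpa [oYX, oXYi] using h₁) hc
    · exact absurd (by simpa [oYX, oXiY, eq_inv_mul_iff_mul_eq] using h₂.symm) hab
    · exact absurd (by simpa [oYX, oXiYi] using h₁) hc
    · refine .inr (.inr ⟨rfl, rfl, fun g x => ?_⟩)
      simpa [oYX, pow_two, mul_assoc] using (H g x).symm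
    · exact .inl (.inr rfl)
    · exact absurd (by simpa [oYX, oYiX] using h₁) hc
    · exact absurd (by simpa [oYX, oYiXi] using h₁) hc

theorem inv_sq_of_pow_four [Group G] {g : G} (h : g ^ 4 = 1) : (g ^ 2)⁻¹ = g ^ 2 := by
  rw [inv_eq_iff_mul_eq_one, ← pow_add, h]

theorem pow_four_of_inv_sq [Group G] {g : G} (h : (g ^ 2)⁻¹ = g ^ 2) : g ^ 4 = 1 := by
  rw [inv_eq_iff_mul_eq_one, ← pow_add] at h
  exact h

/-- Left alternative law in the nonabelian case. -/
theorem statement11 [Group G] [Finite G] (hna : ∃ a b : G, a * b ≠ b * a)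
    (β γ δ : Op G) (hβ : β ∈ ({oXY, oYX, oYXi, oXiY} : Set (Op G)))
    (hγ : γ ∈ ({oXY, oYX} : Set (Op G))) (hδ : δ ∈ Theta G) :
    (∀ x y : G × Bool,
        cmul oXY β γ δ x (cmul oXY β γ δ x y) =
          cmul oXY β γ δ (cmul oXY β γ δ x x) y) ↔
      ((γ, δ) ∈ ({(oXY, oXiY), (oYX, oYXi)} : Set (Op G × Op G)) ∨
       (β, γ, δ) = ((oXY : Op G), (oXY : Op G), (oXY : Op G)) ∨
       ((∀ g x : G, g ^ 2 * x = x * g ^ 2) ∧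
         (β, γ, δ) ∈ ({(oYX, oXY, oXY), (oXY, oYX, oYX), (oYX, oYX, oYX)} :
           Set (Op G × Op G × Op G))) ∨
       ((∀ g : G, g ^ 4 = 1) ∧
         (β, γ, δ) = ((oXiY : Op G), (oXY : Op G), (oXY : Op G))) ∨
       ((∀ g x : G, g ^ 2 * x = x * g ^ 2) ∧ (∀ g : G, g ^ 4 = 1) ∧
         (β, γ, δ) ∈ ({(oYXi, oXY, oXY), (oYXi, oYX, oYX), (oXiY, oYX, oYX)} :
           Set (Op G × Op G × Op G)))) := by
  rw [cmul_leftAlternative_iff]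
  constructor
  · rintro ⟨-, H₂, H₃⟩
    rcases gamma_delta_of_leftAlternative hna hγ hδ H₂ with h | ⟨rfl, rfl⟩ | ⟨rfl, rfl, hz⟩
    · exact .inl h
    · rcases hβ with rfl | rfl | rfl | rfl
      · exact .inr (.inl rfl)
      · have hz (g x : G) : g ^ 2 * x = x * g ^ 2 := by
          simpa [oXY, oYX, pow_two, mul_assoc] using H₃ g x
        exact .inr (.inr (.inl ⟨hz, .inl rfl⟩))
      · have hz (g x : G) : g ^ 2 * x = x * (g ^ 2)⁻¹ := by
          simpa [oXY, oYXi, pow_two, mul_assoc] using H₃ g x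
        have hi (g : G) : (g ^ 2)⁻¹ = g ^ 2 := by simpa using (hz g 1).symm
        simp only [hi] at hz
        exact .inr (.inr (.inr (.inr ⟨hz, fun g => pow_four_of_inv_sq (hi g), .inl rfl⟩)))
      · have hi (g : G) : (g ^ 2)⁻¹ = g ^ 2 := by
          simpa [oXY, oXiY, pow_two] using (H₃ g 1).symm
        exact .inr (.inr (.inr (.inl ⟨fun g => pow_four_of_inv_sq (hi g), rfl⟩)))
    · rcases hβ with rfl | rfl | rfl | rfl
      · exact .inr (.inr (.inl ⟨hz, .inr (.inl rfl)⟩))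
      · exact .inr (.inr (.inl ⟨hz, .inr (.inr rfl)⟩))
      · have hi (g : G) : (g ^ 2)⁻¹ = g ^ 2 := by
          simpa [oYX, oYXi, pow_two] using (H₃ g 1).symm
        exact .inr (.inr (.inr (.inr
          ⟨hz, fun g => pow_four_of_inv_sq (hi g), .inr (.inl rfl)⟩)))
      · have hi (g : G) : (g ^ 2)⁻¹ = g ^ 2 := by
          simpa [oYX, oXiY, pow_two] using (H₃ g 1).symm
        exact .inr (.inr (.inr (.inr
          ⟨hz, fun g => pow_four_of_inv_sq (hi g), .inr (.inr rfl)⟩)))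
  · intro H
    refine ⟨beta_leftAlternative hβ, ?_⟩
    have h_one := beta_one_left hβ
    rcases H with (h | h) | h | ⟨hz, h | h | h⟩ | ⟨h4, h⟩ | ⟨hz, h4, h | h | h⟩ <;>
      simp only [Set.mem_singleton_iff, Prod.mk.injEq] at h
    · obtain ⟨rfl, rfl⟩ := h
      simp [oXY, oXiY, h_one]
    · obtain ⟨rfl, rfl⟩ := h
      simp [oYX, oYXi, h_one]
    all_goals
      obtain ⟨rfl, rfl, rfl⟩ := h
      refine ⟨fun g h => ?_, fun g h => ?_⟩
    · simp [oXY, mul_assoc]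
    · simp [oXY, mul_assoc]
    · simp [oXY, mul_assoc]
    · simpa [oXY, oYX, pow_two, mul_assoc] using hz g h
    · simpa [oYX, pow_two, mul_assoc] using (hz g h).symm
    · simpa [oXY, oYX, pow_two, mul_assoc] using (hz g h).symm
    · simpa [oYX, pow_two, mul_assoc] using (hz g h).symm
    · simp [oYX, mul_assoc]
    · simp [oXY, mul_assoc]
    · simp [oXY, oXiY, ← mul_assoc, ← pow_two, inv_sq_of_pow_four (h4 g)]
    · simp [oXY, mul_assoc]
    · simp only [oXY, oYXi, ← mul_assoc, ← pow_two, inv_sq_of_pow_four (h4 g), hz g h]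
    · simpa [oYX, pow_two, mul_assoc] using (hz g h).symm
    · simp only [oYX, oYXi, mul_assoc, ← pow_two, inv_sq_of_pow_four (h4 g)]
    · simpa [oYX, pow_two, mul_assoc] using (hz g h).symm
    · simp only [oYX, oXiY, mul_assoc, ← pow_two, inv_sq_of_pow_four (h4 g), hz g h]
end
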